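/- arXiv:0707.0659 — 2 statements merged into one kernel-verified Lean document; each statement's English description precedes it below -/
import Mathlib

section
/- For every α ∈ ℂ, the family of polynomials (f^k(1))_{k ∈ ℕ} (iterates of the operator f applied to the constant polynomial 1) is a ℂ-basis of ℂ[x]. (Together with the sl₂-relations and e(1)=0, h(1)=2α·1, this says that ℂ_α[x] is isomorphic to the Verma module over sl₂(ℂ) of highest weight 2α with highest weight vector 1 — Theorem 4.1 of the paper.) -/
open Polynomial

/-- The operator `E_m` on `ℂ[x]` given by `(E_m p)(x) = (α·m − x)·p(x+m)`. -/
noncomputable def E (α : ℂ) (m : ℤ) : Module.End ℂ (Polynomial ℂ) :=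
  LinearMap.mulLeft ℂ (C (α * m) - X) ∘ₗ (aeval (X + C (m : ℂ))).toLinearMap

/-- `f = −½(E₁ + 2E₀ + E₋₁)`. -/
noncomputable def fOp (α : ℂ) : Module.End ℂ (Polynomial ℂ) :=
  -((1/2 : ℂ) • (E α 1 + (2 : ℂ) • E α 0 + E α (-1)))

theorem E_apply (α : ℂ) (m : ℤ) (p : ℂ[X]) :
    E α m p = (C (α * m) - X) * taylor (m : ℂ) p := by
  simp [E, taylor_apply, comp, aeval_def]

theorem natDegree_E_apply_le (α : ℂ) (m : ℤ) (p : ℂ[X]) :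
    (E α m p).natDegree ≤ p.natDegree + 1 := by
  rw [E_apply, add_comm]
  refine natDegree_mul_le_of_le ?_ (natDegree_taylor p _).le
  exact (natDegree_sub_le _ _).trans (by rw [natDegree_C, natDegree_X]; simp)

theorem coeff_E_apply (α : ℂ) (m : ℤ) (p : ℂ[X]) :
    (E α m p).coeff (p.natDegree + 1) = -p.leadingCoeff := by
  have h : (taylor (m : ℂ) p).coeff (p.natDegree + 1) = 0 :=
    coeff_eq_zero_of_natDegree_lt (by simp)
  rw [E_apply, sub_mul, coeff_sub, coeff_C_mul, coeff_X_mul, h, coeff_taylor_natDegree]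
  ring

theorem natDegree_fOp_apply_le (α : ℂ) (p : ℂ[X]) :
    (fOp α p).natDegree ≤ p.natDegree + 1 := by
  simp only [fOp, LinearMap.neg_apply, LinearMap.smul_apply, LinearMap.add_apply, natDegree_neg]
  refine (natDegree_smul_le _ _).trans (natDegree_add_le_of_degree_le
    (natDegree_add_le_of_degree_le (natDegree_E_apply_le ..) ?_) (natDegree_E_apply_le ..))
  exact (natDegree_smul_le _ _).trans (natDegree_E_apply_le ..)

theorem coeff_fOp_apply (α : ℂ) (p : ℂ[X]) :
    (fOp α p).coeff (p.natDegree + 1) = 2 * p.leadingCoeff := by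
  simp only [fOp, LinearMap.neg_apply, LinearMap.smul_apply, LinearMap.add_apply, coeff_neg,
    coeff_smul, coeff_add, coeff_E_apply, smul_eq_mul]
  ring

theorem degree_fOp_apply (α : ℂ) {p : ℂ[X]} {n : ℕ} (hp : p.degree = n) :
    (fOp α p).degree = (n + 1 : ℕ) := by
  have hp0 : p ≠ 0 := by
    rintro rfl
    simp at hp
  obtain rfl := natDegree_eq_of_degree_eq_some hp
  refine degree_eq_of_le_of_coeff_ne_zero
    (natDegree_le_iff_degree_le.mp (natDegree_fOp_apply_le α p)) ?_
  rw [coeff_fOp_apply]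
  exact mul_ne_zero two_ne_zero (leadingCoeff_ne_zero.mpr hp0)

/-- The polynomials `f^k(1)`, whose degrees are `k`. -/
noncomputable def fOpIterates (α : ℂ) : Polynomial.Sequence ℂ where
  elems' k := (fOp α ^ k) 1
  degree_eq' k := by
    induction k with
    | zero => simp
    | succ k ih =>
      rw [pow_succ', Module.End.mul_apply]
      exact degree_fOp_apply α ih

/-- The family `(f^k(1))_{k ∈ ℕ}` is a `ℂ`-basis of `ℂ[x]`; hence `ℂ_α[x]` is
isomorphic to the Verma module over `sl₂(ℂ)` of highest weight `2α` with
highest weight vector `1`. -/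
theorem iterates_f_one_basis (α : ℂ) :
    LinearIndependent ℂ (fun k : ℕ => (fOp α ^ k) (1 : Polynomial ℂ)) ∧
    Submodule.span ℂ (Set.range fun k : ℕ => (fOp α ^ k) (1 : Polynomial ℂ)) = ⊤ := by
  exact ⟨(fOpIterates α).linearIndependent, (fOpIterates α).span fun k =>
    (leadingCoeff_ne_zero.mpr ((fOpIterates α).ne_zero k)).isUnit⟩
end

section
/- Let α₁, α₂ ∈ ℂ and suppose that 2(α₁ + α₂) is not a non-negative integer (equivalently, the numbers ω_n = n²/2 − n(α₁ + α₂ + ½) + α₁α₂, n ∈ ℕ, are pairwise distinct). Then Ω is diagonalizable on ℂ[x,y]: the eigenvectors of Ω span ℂ[x,y]. (Remark following Proposition 4.3.) -/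
open MvPolynomial

/-- The substitution `p(x,y) ↦ p(x+a, y+b)` on `ℂ[x,y]`. -/
noncomputable def shift (a b : ℂ) : MvPolynomial (Fin 2) ℂ →ₐ[ℂ] MvPolynomial (Fin 2) ℂ :=
  aeval ![X 0 + C a, X 1 + C b]

/-- The Casimir operator `Ω` on `ℂ[x,y]`:
`(Ω p)(x,y) = −½(x−α₁)(y+α₂)·p(x+1,y−1) + xy·p(x,y) − ½(x+α₁)(y−α₂)·p(x−1,y+1)`. -/
noncomputable def Omega (α₁ α₂ : ℂ) : Module.End ℂ (MvPolynomial (Fin 2) ℂ) :=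
  (-(1/2 : ℂ)) • (LinearMap.mulLeft ℂ ((X 0 - C α₁) * (X 1 + C α₂)) ∘ₗ
      (shift 1 (-1)).toLinearMap)
  + LinearMap.mulLeft ℂ ((X 0 : MvPolynomial (Fin 2) ℂ) * X 1)
  + (-(1/2 : ℂ)) • (LinearMap.mulLeft ℂ ((X 0 + C α₁) * (X 1 - C α₂)) ∘ₗ
      (shift (-1) 1).toLinearMap)

/-- An endomorphism acting triangularly along a filtration `U`, with pairwise distinct diagonal
entries `ω n`, is diagonalizable on every step of the filtration. -/
theorem le_iSup_eigenspace_of_triangular {K M : Type*} [Field K] [AddCommGroup M] [Module K M]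
    (f : Module.End K M) (U : ℕ → Submodule K M) (ω : ℕ → K) (hω : Function.Injective ω)
    (hU₀ : U 0 = ⊥) (hU : ∀ n, ∀ u ∈ U (n + 1), f u - ω n • u ∈ U n) (n : ℕ) :
    U n ≤ ⨆ μ, f.eigenspace μ := by
  let P (n : ℕ) : Polynomial K := ∏ k ∈ Finset.range n, (Polynomial.X - Polynomial.C (ω k))
  have hker : ∀ n, U n ≤ LinearMap.ker (Polynomial.aeval f (P n)) := by
    intro n
    induction n with
    | zero => simp [hU₀]
    | succ n ih =>
      intro u hu
      have := ih (hU n u hu)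
      simp only [P, Finset.prod_range_succ, LinearMap.mem_ker, map_mul, Module.End.mul_apply]
      simpa [Module.algebraMap_end_apply] using this
  have hsup : ∀ n, LinearMap.ker (Polynomial.aeval f (P n)) ≤ ⨆ μ, f.eigenspace μ := by
    intro n
    induction n with
    | zero => simp [P, Module.End.one_eq_id]
    | succ n ih =>
      have hcop : IsCoprime (P n) (Polynomial.X - Polynomial.C (ω n)) :=
        IsCoprime.prod_left fun k hk =>
          Polynomial.pairwise_coprime_X_sub_C hω (Finset.mem_range.mp hk).ne
      simp only [P, Finset.prod_range_succ]
      rw [← Polynomial.sup_ker_aeval_eq_ker_aeval_mul_of_coprime f hcop]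
      refine sup_le ih fun v hv => ?_
      refine Submodule.mem_iSup_of_mem (ω n) (Module.End.mem_eigenspace_iff.mpr ?_)
      simpa [Module.algebraMap_end_apply, sub_eq_zero] using hv
  exact (hker n).trans (hsup n)

/-- The span of the products `(x + y)ᵐ xᵏ` with `k < n`. -/
noncomputable def degreeLT (n : ℕ) : Submodule ℂ (MvPolynomial (Fin 2) ℂ) :=
  Submodule.span ℂ {p | ∃ k < n, ∃ m : ℕ, p = (X 0 + X 1) ^ m * X 0 ^ k}

theorem degreeLT_zero : degreeLT 0 = ⊥ := by
  simp [degreeLT]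

theorem degreeLT_mono : Monotone degreeLT := fun _ _ hab =>
  Submodule.span_mono fun _ ⟨k, hk, m, hp⟩ => ⟨k, hk.trans_le hab, m, hp⟩

theorem X_pow_mem_degreeLT (n : ℕ) : X 0 ^ n ∈ degreeLT (n + 1) :=
  Submodule.subset_span ⟨n, n.lt_succ_self, 0, by simp⟩

theorem X_mul_mem_degreeLT {n : ℕ} {p : MvPolynomial (Fin 2) ℂ} (hp : p ∈ degreeLT n) :
    X 0 * p ∈ degreeLT (n + 1) := by
  refine Submodule.span_induction (p := fun p _ => X 0 * p ∈ degreeLT (n + 1))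
    ?_ ?_ ?_ ?_ hp
  · rintro _ ⟨k, hk, m, rfl⟩
    exact Submodule.subset_span ⟨k + 1, by omega, m, by ring⟩
  · simp
  · intro a b _ _ ha hb
    simpa [mul_add] using add_mem ha hb
  · intro c a _ ha
    simpa using Submodule.smul_mem _ c ha

theorem add_pow_mul_mem_degreeLT (m : ℕ) {n : ℕ} {p : MvPolynomial (Fin 2) ℂ}
    (hp : p ∈ degreeLT n) : (X 0 + X 1) ^ m * p ∈ degreeLT n := by
  refine Submodule.span_induction (p := fun p _ => (X 0 + X 1) ^ m * p ∈ degreeLT n)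
    ?_ ?_ ?_ ?_ hp
  · rintro _ ⟨k, hk, l, rfl⟩
    exact Submodule.subset_span ⟨k, hk, m + l, by ring⟩
  · simp
  · intro a b _ _ ha hb
    simpa [mul_add] using add_mem ha hb
  · intro c a _ ha
    simpa using Submodule.smul_mem _ c ha

theorem C_mul_mem_degreeLT (c : ℂ) {n : ℕ} {p : MvPolynomial (Fin 2) ℂ}
    (hp : p ∈ degreeLT n) : C c * p ∈ degreeLT n := by
  simpa [smul_eq_C_mul] using Submodule.smul_mem _ c hp

theorem exists_mem_degreeLT (p : MvPolynomial (Fin 2) ℂ) : ∃ n, p ∈ degreeLT n := by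
  induction p using MvPolynomial.induction_on with
  | C c => exact ⟨1, by simpa using C_mul_mem_degreeLT c (X_pow_mem_degreeLT 0)⟩
  | add p q hp hq =>
    obtain ⟨a, ha⟩ := hp
    obtain ⟨b, hb⟩ := hq
    exact ⟨max a b, add_mem (degreeLT_mono (le_max_left a b) ha)
      (degreeLT_mono (le_max_right a b) hb)⟩
  | mul_X p i hp =>
    obtain ⟨n, hn⟩ := hp
    have h₀ := X_mul_mem_degreeLT hn
    refine ⟨n + 1, ?_⟩
    fin_cases i
    · simpa [mul_comm] using h₀
    · have h₁ := degreeLT_mono n.le_succ (add_pow_mul_mem_degreeLT 1 hn)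
      convert sub_mem h₁ h₀ using 1
      change p * X 1 = _
      ring

/-- Leading terms in `x` of the first and second central differences of `xⁿ`. -/
theorem central_differences_mem_degreeLT (n : ℕ) :
    let P : MvPolynomial (Fin 2) ℂ := (X 0 + 1) ^ n + (X 0 - 1) ^ n - 2 * X 0 ^ n
    let Q : MvPolynomial (Fin 2) ℂ := (X 0 + 1) ^ n - (X 0 - 1) ^ n
    P ∈ degreeLT n ∧ X 0 * P ∈ degreeLT n ∧
      X 0 ^ 2 * P - C ((n : ℂ) * (n - 1)) * X 0 ^ n ∈ degreeLT n ∧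
      Q ∈ degreeLT n ∧ X 0 * Q - C (2 * (n : ℂ)) * X 0 ^ n ∈ degreeLT n := by
  induction n with
  | zero => norm_num
  | succ n ih =>
    obtain ⟨hP, hxP, hxxP, hQ, hxQ⟩ := ih
    have up {p} (hp : p ∈ degreeLT n) : p ∈ degreeLT (n + 1) := degreeLT_mono n.le_succ hp
    have hC (c : ℂ) := C_mul_mem_degreeLT c (X_pow_mem_degreeLT n)
    refine ⟨?_, ?_, ?_, ?_, ?_⟩
    · convert add_mem (up hxP) (up hQ) using 1
      ring
    · convert add_mem (add_mem (up hxxP) (up hxQ)) (hC (n * (n - 1) + 2 * n)) using 1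
      simp only [map_add]
      ring
    · convert add_mem (X_mul_mem_degreeLT hxxP) (X_mul_mem_degreeLT hxQ) using 1
      simp only [map_mul, map_sub, map_natCast, map_one, map_ofNat]
      push_cast
      ring
    · convert add_mem (add_mem (up hxQ) (up hP)) (hC (2 * n + 2)) using 1
      simp only [map_add, map_ofNat]
      ring
    · convert add_mem (X_mul_mem_degreeLT hxQ) (up hxP) using 1
      push_cast
      simp only [map_mul, map_add, map_natCast, map_one, map_ofNat]
      ring

theorem Omega_apply (α₁ α₂ : ℂ) (p : MvPolynomial (Fin 2) ℂ) :
    Omega α₁ α₂ p = C (-(1 / 2)) * ((X 0 - C α₁) * (X 1 + C α₂) * shift 1 (-1) p)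
      + X 0 * X 1 * p + C (-(1 / 2)) * ((X 0 + C α₁) * (X 1 - C α₂) * shift (-1) 1 p) := by
  simp only [Omega, LinearMap.add_apply, LinearMap.smul_apply, LinearMap.comp_apply,
    LinearMap.mulLeft_apply, AlgHom.toLinearMap_apply, smul_eq_C_mul]

/-- The eigenvalue `ωₙ = n²/2 − n(α₁ + α₂ + ½) + α₁α₂`. -/
noncomputable def omegaEigenvalue (α₁ α₂ : ℂ) (n : ℕ) : ℂ :=
  (n : ℂ) ^ 2 / 2 - n * (α₁ + α₂ + 1 / 2) + α₁ * α₂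

theorem omegaEigenvalue_injective {α₁ α₂ : ℂ} (h : ∀ n : ℕ, 2 * (α₁ + α₂) ≠ (n : ℂ)) :
    Function.Injective (omegaEigenvalue α₁ α₂) := by
  intro n m hnm
  by_contra hne
  have hsub : (n : ℂ) - m ≠ 0 := sub_ne_zero.mpr (Nat.cast_injective.ne hne)
  have hmul : ((n : ℂ) - m) * ((n + m - 1) - 2 * (α₁ + α₂)) = 0 := by
    unfold omegaEigenvalue at hnm
    linear_combination 2 * hnm
  have hsum := (mul_eq_zero.mp hmul).resolve_left hsub
  refine h (n + m - 1) ?_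
  rw [Nat.cast_sub (by omega)]
  push_cast
  linear_combination -hsum

theorem Omega_X_pow_sub_mem_degreeLT (α₁ α₂ : ℂ) (n : ℕ) :
    Omega α₁ α₂ (X 0 ^ n) - C (omegaEigenvalue α₁ α₂ n) * X 0 ^ n ∈ degreeLT n := by
  obtain ⟨hP, hxP, hxxP, hQ, hxQ⟩ := central_differences_mem_degreeLT n
  have hsxP := add_pow_mul_mem_degreeLT 1 hxP
  have hsQ := add_pow_mul_mem_degreeLT 1 hQ
  have hdiff₂ := add_mem (sub_mem hsxP hxxP) (C_mul_mem_degreeLT (-(α₁ * α₂)) hP)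
  have hdiff₁ := add_mem (C_mul_mem_degreeLT (α₁ + α₂) hxQ) (C_mul_mem_degreeLT (-α₁) hsQ)
  convert C_mul_mem_degreeLT (-(1 / 2)) (add_mem hdiff₂ hdiff₁) using 1
  have hhalf : (C (1 / 2) : MvPolynomial (Fin 2) ℂ) * 2 = 1 := by
    rw [← map_ofNat C 2, ← map_mul]
    norm_num
  have hω : omegaEigenvalue α₁ α₂ n =
      (1 / 2) * n ^ 2 - n * (α₁ + α₂ + 1 / 2) + α₁ * α₂ := by
    unfold omegaEigenvalue
    ring
  rw [Omega_apply, hω]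
  simp only [shift, map_pow, aeval_X, Matrix.cons_val_zero, map_mul, map_add, map_sub, map_neg,
    map_natCast, map_one, map_ofNat, pow_one]
  generalize (C (1 / 2) : MvPolynomial (Fin 2) ℂ) = e at hhalf ⊢
  linear_combination
    X 0 ^ n * (C α₁ * C α₂ - X 0 * X 1 - (n : MvPolynomial (Fin 2) ℂ) * (C α₁ + C α₂)) * hhalf

theorem Omega_add_pow_mul (α₁ α₂ : ℂ) (m : ℕ) (p : MvPolynomial (Fin 2) ℂ) :
    Omega α₁ α₂ ((X 0 + X 1) ^ m * p) = (X 0 + X 1) ^ m * Omega α₁ α₂ p := by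
  have hshift (a : ℂ) : shift a (-a) (X 0 + X 1) = X 0 + X 1 := by
    simp only [shift, map_add, aeval_X, Matrix.cons_val_zero, Matrix.cons_val_one, map_neg]
    ring
  have hshift' : shift (-1) 1 (X 0 + X 1) = X 0 + X 1 := by
    simpa using hshift (-1)
  simp only [Omega_apply, map_mul (shift _ _), map_pow (shift _ _), hshift, hshift']
  ring

theorem Omega_sub_mem_degreeLT (α₁ α₂ : ℂ) (n : ℕ) :
    ∀ u ∈ degreeLT (n + 1), Omega α₁ α₂ u - omegaEigenvalue α₁ α₂ n • u ∈ degreeLT n := by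
  intro u hu
  refine Submodule.span_induction
    (p := fun u _ => Omega α₁ α₂ u - omegaEigenvalue α₁ α₂ n • u ∈ degreeLT n) ?_ ?_ ?_ ?_ hu
  · rintro _ ⟨k, hk, m, rfl⟩
    have hlead := Omega_X_pow_sub_mem_degreeLT α₁ α₂ k
    rw [Omega_add_pow_mul, ← mul_smul_comm, ← mul_sub, smul_eq_C_mul]
    refine add_pow_mul_mem_degreeLT m ?_
    rcases (Nat.lt_succ_iff.mp hk).eq_or_lt with rfl | hlt
    · exact hlead
    · have hX := degreeLT_mono hlt (X_pow_mem_degreeLT k)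
      convert add_mem (degreeLT_mono hlt.le hlead) (C_mul_mem_degreeLT
        (omegaEigenvalue α₁ α₂ k - omegaEigenvalue α₁ α₂ n) hX) using 1
      rw [map_sub]
      ring
  · simp
  · intro a b _ _ ha hb
    convert add_mem ha hb using 1
    rw [map_add, smul_add]
    abel
  · intro c a _ ha
    convert Submodule.smul_mem _ c ha using 1
    rw [map_smul, smul_sub, smul_comm c]

/-- If `2(α₁ + α₂)` is not a non-negative integer, then `Ω` is diagonalizable
on `ℂ[x,y]`: its eigenvectors span `ℂ[x,y]`. -/
theorem Omega_diagonalizable (α₁ α₂ : ℂ)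
    (h : ∀ n : ℕ, 2 * (α₁ + α₂) ≠ (n : ℂ)) :
    Submodule.span ℂ {p : MvPolynomial (Fin 2) ℂ | ∃ μ : ℂ, Omega α₁ α₂ p = μ • p} = ⊤ := by
  refine eq_top_iff.mpr fun p _ => ?_
  obtain ⟨n, hn⟩ := exists_mem_degreeLT p
  have hp := le_iSup_eigenspace_of_triangular (Omega α₁ α₂) degreeLT (omegaEigenvalue α₁ α₂)
    (omegaEigenvalue_injective h) degreeLT_zero (Omega_sub_mem_degreeLT α₁ α₂) n hn
  have hle : ⨆ μ, (Omega α₁ α₂).eigenspace μ ≤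
      Submodule.span ℂ {p | ∃ μ : ℂ, Omega α₁ α₂ p = μ • p} :=
    iSup_le fun μ q hq => Submodule.subset_span ⟨μ, Module.End.mem_eigenspace_iff.mp hq⟩
  exact hle hp
end
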